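/- For any distribution D on X × {-1,1}, any set H of voters f : X → [-1,1], any prior distribution P on H, and any δ ∈ (0,1]: with probability at least 1 − δ over the draw of S ∼ D^m, simultaneously for all posterior distributions Q on H, kl(R_S(G_Q) ‖ R_D(G_Q)) ≤ (1/m)·[KL(Q‖P) + ln(ξ(m)/δ)]. -/

import Mathlib

open MeasureTheory

open Classical in
/-- Kullback–Leibler divergence `KL(Q‖P) = E_{f∼Q} ln (dQ/dP)(f)`, with value `⊤`
when `Q` is not absolutely continuous w.r.t. `P` or the divergence is not finite. -/
noncomputable def klDivE {ι : Type*} [MeasurableSpace ι] (Q P : Measure ι) : EReal :=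
  if Q ≪ P ∧ Integrable (fun i => Real.log ((Q.rnDeriv P) i).toReal) Q
  then ((∫ i, Real.log ((Q.rnDeriv P) i).toReal ∂Q : ℝ) : EReal)
  else ⊤

/-- `kl(q‖p)`: the KL divergence between Bernoulli distributions of parameters `q`, `p`. -/
noncomputable def klBin (q p : ℝ) : ℝ :=
  q * Real.log (q / p) + (1 - q) * Real.log ((1 - q) / (1 - p))

/-- `ξ(m) = Σ_{k=0}^m C(m,k)·(k/m)^k·(1 - k/m)^{m-k}` (with `0⁰ = 1`). -/
noncomputable def xi (m : ℕ) : ℝ :=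
  ∑ k ∈ Finset.range (m + 1),
    (m.choose k : ℝ) * ((k : ℝ) / (m : ℝ)) ^ k * (1 - (k : ℝ) / (m : ℝ)) ^ (m - k)

/-- Empirical Gibbs risk (linear loss `L_ℓ(f(x),y) = (1 - y·f(x))/2`) of posterior `Q`
on the sample `S`. -/
noncomputable def empGibbs {X ι : Type*} [MeasurableSpace ι] (F : ι → X → ℝ) {m : ℕ}
    (S : Fin m → X × ℝ) (Q : Measure ι) : ℝ :=
  ∫ i, (m : ℝ)⁻¹ * ∑ k, (1 - (S k).2 * F i (S k).1) / 2 ∂Q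

/-- True Gibbs risk of posterior `Q` under `D`. -/
noncomputable def trueGibbs {X ι : Type*} [MeasurableSpace X] [MeasurableSpace ι]
    (F : ι → X → ℝ) (D : Measure (X × ℝ)) (Q : Measure ι) : ℝ :=
  ∫ i, ∫ p, (1 - p.2 * F i p.1) / 2 ∂D ∂Q


theorem mul_log_div_eq (x : ℝ) {y : ℝ} (hy : y ≠ 0) :
    x * Real.log (x / y) = x * Real.log x - x * Real.log y := by
  rcases eq_or_ne x 0 with rfl | hx
  · simp
  · rw [Real.log_div hx hy]; ring

theorem convexOn_klBin_left {p : ℝ} (hp : p ∈ Set.Ioo (0 : ℝ) 1) :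
    ConvexOn ℝ (Set.Icc (0 : ℝ) 1) fun q => klBin q p := by
  have h1 : ConvexOn ℝ (Set.Icc (0 : ℝ) 1) fun q : ℝ => q * Real.log q :=
    Real.convexOn_mul_log.subset (fun x hx => hx.1) (convex_Icc 0 1)
  have h2 : ConvexOn ℝ (Set.Icc (0 : ℝ) 1) fun q : ℝ => (1 - q) * Real.log (1 - q) := by
    refine ⟨convex_Icc 0 1, fun x hx y hy a b ha hb hab => ?_⟩
    have := Real.convexOn_mul_log.2 (Set.mem_Ici.2 (sub_nonneg.2 hx.2))
      (Set.mem_Ici.2 (sub_nonneg.2 hy.2)) ha hb hab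
    have e : 1 - (a • x + b • y) = a • (1 - x) + b • (1 - y) := by
      simp only [smul_eq_mul]; linear_combination -hab
    simpa only [e] using this
  refine ⟨convex_Icc 0 1, fun x hx y hy a b ha hb hab => ?_⟩
  have e1 := h1.2 hx hy ha hb hab
  have e2 := h2.2 hx hy ha hb hab
  simp only [klBin, mul_log_div_eq _ hp.1.ne', mul_log_div_eq _ (sub_pos.2 hp.2).ne',
    smul_eq_mul] at *
  have hb' : b = 1 - a := by linarith
  subst hb'
  linarith

theorem convexOn_exp_mul_klBin_left {p c : ℝ} (hp : p ∈ Set.Ioo (0 : ℝ) 1) (hc : 0 ≤ c) :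
    ConvexOn ℝ (Set.Icc (0 : ℝ) 1) fun q => Real.exp (c * klBin q p) := by
  have h := (convexOn_klBin_left hp).smul hc
  refine ⟨convex_Icc 0 1, fun x hx y hy a b ha hb hab => ?_⟩
  exact (Real.exp_le_exp.2 (h.2 hx hy ha hb hab)).trans
    (convexOn_exp.2 (Set.mem_univ _) (Set.mem_univ _) ha hb hab)

theorem sum_finset_prod_ite {κ : Type*} [Fintype κ] [DecidableEq κ] (f g : κ → ℝ) :
    ∑ t : Finset κ, ∏ k, (if k ∈ t then f k else g k) = ∏ k, (f k + g k) := by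
  rw [Finset.prod_add, Finset.powerset_univ]
  refine Finset.sum_congr rfl fun t _ => ?_
  rw [Finset.prod_ite]
  congr 1 <;> refine Finset.prod_congr ?_ fun _ _ => rfl <;> ext <;> simp

theorem sum_finset_prod_ite_mul_card {κ : Type*} [Fintype κ] [DecidableEq κ] (z : κ → ℝ) :
    ∑ t : Finset κ, (∏ k, (if k ∈ t then z k else 1 - z k)) * (t.card : ℝ) = ∑ k, z k := by
  have hcard (t : Finset κ) : (t.card : ℝ) = ∑ j, if j ∈ t then (1 : ℝ) else 0 := by simp
  simp_rw [hcard, Finset.mul_sum]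
  rw [Finset.sum_comm]
  refine Finset.sum_congr rfl fun j _ => ?_
  calc _ = ∑ t : Finset κ, ∏ k, (if k ∈ t then z k else if k = j then 0 else 1 - z k) := by
        refine Finset.sum_congr rfl fun t _ => ?_
        by_cases hj : j ∈ t
        · simp only [hj, if_true, mul_one]
          refine Finset.prod_congr rfl fun k _ => ?_
          by_cases hk : k ∈ t
          · simp [hk]
          · have : k ≠ j := fun h => hk (h ▸ hj)
            simp [hk, this]
        · simp only [hj, if_false, mul_zero]
          exact (Finset.prod_eq_zero (Finset.mem_univ j) (by simp [hj])).symm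
    _ = ∏ k, (z k + if k = j then 0 else 1 - z k) := sum_finset_prod_ite _ _
    _ = z j := by
        rw [Finset.prod_eq_single j]
        · simp
        · intro k _ hk; simp [hk]
        · simp

theorem ConvexOn.map_average_le_sum_finset {φ : ℝ → ℝ} (hφ : ConvexOn ℝ (Set.Icc (0 : ℝ) 1) φ)
    {m : ℕ} (z : Fin m → ℝ) (hz : ∀ k, z k ∈ Set.Icc (0 : ℝ) 1) :
    φ ((m : ℝ)⁻¹ * ∑ k, z k) ≤
      ∑ t : Finset (Fin m), (∏ k, (if k ∈ t then z k else 1 - z k)) * φ (t.card / m) := by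
  have h := hφ.map_sum_le (t := Finset.univ)
    (w := fun t : Finset (Fin m) => ∏ k, (if k ∈ t then z k else 1 - z k))
    (p := fun t => (t.card / m : ℝ)) ?_ ?_ ?_
  · simp only [smul_eq_mul] at h
    refine le_trans (le_of_eq ?_) h
    congr 1
    rw [← sum_finset_prod_ite_mul_card, Finset.mul_sum]
    exact Finset.sum_congr rfl fun t _ => by ring
  · intro t _
    refine Finset.prod_nonneg fun k _ => ?_
    split_ifs
    · exact (hz k).1
    · exact sub_nonneg.2 (hz k).2
  · rw [sum_finset_prod_ite]; simp
  · intro t _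
    have : (t.card : ℝ) ≤ m := by
      exact_mod_cast (Finset.card_le_univ t).trans_eq (Fintype.card_fin m)
    exact ⟨by positivity, div_le_one_of_le₀ this (Nat.cast_nonneg m)⟩

theorem pow_mul_exp_mul_log_div {k m : ℕ} (hm : 0 < m) {p : ℝ} (hp : 0 < p) :
    p ^ k * Real.exp (m * ((k / m : ℝ) * Real.log ((k / m : ℝ) / p))) = (k / m : ℝ) ^ k := by
  rcases Nat.eq_zero_or_pos k with rfl | hk
  · simp
  have hm' : (0 : ℝ) < m := by exact_mod_cast hm
  have hk' : (0 : ℝ) < k := by exact_mod_cast hk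
  have e : (m : ℝ) * ((k / m : ℝ) * Real.log ((k / m : ℝ) / p))
      = k * Real.log ((k / m : ℝ) / p) := by field_simp
  rw [e, Real.exp_nat_mul, Real.exp_log (by positivity), ← mul_pow]
  congr 1
  field_simp

theorem pow_mul_pow_mul_exp_klBin {k m : ℕ} (hm : 0 < m) (hk : k ≤ m) {p : ℝ}
    (hp : p ∈ Set.Ioo (0 : ℝ) 1) :
    p ^ k * (1 - p) ^ (m - k) * Real.exp (m * klBin (k / m) p)
      = (k / m : ℝ) ^ k * (1 - k / m : ℝ) ^ (m - k) := by
  have hm' : (m : ℝ) ≠ 0 := by exact_mod_cast hm.ne'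
  have e : (1 - k / m : ℝ) = ((m - k : ℕ) : ℝ) / m := by
    rw [Nat.cast_sub hk]; field_simp
  rw [klBin, mul_add, Real.exp_add, e]
  rw [← pow_mul_exp_mul_log_div (k := k) hm hp.1,
    ← pow_mul_exp_mul_log_div (k := m - k) hm (sub_pos.2 hp.2)]
  ring

theorem sum_finset_pow_mul_exp_klBin {m : ℕ} (hm : 0 < m) {p : ℝ}
    (hp : p ∈ Set.Ioo (0 : ℝ) 1) :
    ∑ t : Finset (Fin m), (∏ k, (if k ∈ t then p else 1 - p)) *
      Real.exp (m * klBin (t.card / m) p) = xi m := by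
  rw [← Finset.powerset_univ, Finset.sum_powerset, xi, Finset.card_univ, Fintype.card_fin]
  refine Finset.sum_congr rfl fun j hj => ?_
  have hj' : j ≤ m := by simpa [Nat.lt_succ_iff] using hj
  rw [mul_assoc, ← pow_mul_pow_mul_exp_klBin hm hj' hp,
    Finset.sum_congr rfl (g := fun _ => p ^ j * (1 - p) ^ (m - j) * Real.exp (m * klBin (j / m) p))]
  · simp [Finset.card_powersetCard]
  · intro t ht
    obtain ⟨-, ht⟩ := Finset.mem_powersetCard.1 ht
    have hc : (Finset.univ.filter fun k => k ∉ t).card = m - j := by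
      rw [← Finset.compl_filter, Finset.card_compl]; simp [ht]
    rw [Finset.prod_ite, Finset.prod_const, Finset.prod_const, hc]
    simp [ht]

theorem one_le_xi {m : ℕ} (hm : 0 < m) : 1 ≤ xi m := by
  have hm' : (0 : ℝ) < m := by exact_mod_cast hm
  have h : ∀ k ∈ Finset.range (m + 1),
      0 ≤ (m.choose k : ℝ) * ((k : ℝ) / (m : ℝ)) ^ k * (1 - (k : ℝ) / (m : ℝ)) ^ (m - k) := by
    intro k hk
    have hk' : (k : ℝ) ≤ m := by exact_mod_cast Nat.lt_succ_iff.1 (Finset.mem_range.1 hk)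
    have : 0 ≤ 1 - (k : ℝ) / m := sub_nonneg.2 (div_le_one_of_le₀ hk' hm'.le)
    positivity
  have := Finset.single_le_sum h (Finset.mem_range.2 (Nat.succ_pos m))
  simpa [xi] using this

theorem ae_pi_forall {Z : Type*} [MeasurableSpace Z] (μ : Measure Z) [IsProbabilityMeasure μ]
    {m : ℕ} {s : Z → Prop} (h : ∀ᵐ p ∂μ, s p) :
    ∀ᵐ S ∂(Measure.pi fun _ : Fin m => μ), ∀ k, s (S k) :=
  Filter.eventually_all.2 fun _ => Measure.tendsto_eval_ae_ae.eventually h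

theorem ae_pi_average_eq_of_integral_eq {Z : Type*} [MeasurableSpace Z] (μ : Measure Z)
    [IsProbabilityMeasure μ] {m : ℕ} (hm : 0 < m) {z : Z → ℝ} (hz : Integrable z μ)
    (hz' : ∀ᵐ p ∂μ, z p ∈ Set.Icc (0 : ℝ) 1) :
    ∀ᵐ S ∂(Measure.pi fun _ : Fin m => μ),
      (∫ p, z p ∂μ = 0 → (m : ℝ)⁻¹ * ∑ k, z (S k) = 0) ∧
      (∫ p, z p ∂μ = 1 → (m : ℝ)⁻¹ * ∑ k, z (S k) = 1) := by
  have hm' : (m : ℝ) ≠ 0 := by exact_mod_cast hm.ne'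
  have key : ∀ᵐ p ∂μ, (∫ p, z p ∂μ = 0 → z p = 0) ∧ (∫ p, z p ∂μ = 1 → z p = 1) := by
    refine Filter.Eventually.and ?_ ?_
    · by_cases h : ∫ p, z p ∂μ = 0
      · filter_upwards [(integral_eq_zero_iff_of_nonneg_ae (hz'.mono fun p hp => hp.1) hz).1 h]
          with p hp _ using hp
      · exact Filter.Eventually.of_forall fun p h' => absurd h' h
    · by_cases h : ∫ p, z p ∂μ = 1
      · have h0 : ∫ p, (1 - z p) ∂μ = 0 := by
          rw [integral_sub (integrable_const _) hz, h]; simp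
        filter_upwards [(integral_eq_zero_iff_of_nonneg_ae
          (hz'.mono fun p hp => sub_nonneg.2 hp.2) ((integrable_const _).sub hz)).1 h0]
          with p hp _
        have : 1 - z p = 0 := hp
        linarith
      · exact Filter.Eventually.of_forall fun p h' => absurd h' h
  filter_upwards [ae_pi_forall μ key] with S hS
  constructor
  · intro h
    simp [fun k => (hS k).1 h]
  · intro h
    simp [fun k => (hS k).2 h, hm']

theorem lintegral_exp_klBin_le_xi {Z : Type*} [MeasurableSpace Z] (μ : Measure Z)
    [IsProbabilityMeasure μ] {m : ℕ} (hm : 0 < m) {z : Z → ℝ} (hz : Integrable z μ)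
    (hz' : ∀ᵐ p ∂μ, z p ∈ Set.Icc (0 : ℝ) 1) :
    ∫⁻ S, ENNReal.ofReal (Real.exp (m * klBin ((m : ℝ)⁻¹ * ∑ k, z (S k)) (∫ p, z p ∂μ)))
      ∂(Measure.pi fun _ : Fin m => μ) ≤ ENNReal.ofReal (xi m) := by
  set R := ∫ p, z p ∂μ with hR
  have hR0 : 0 ≤ R := integral_nonneg_of_ae (hz'.mono fun p hp => hp.1)
  have hR1 : R ≤ 1 := by
    calc R ≤ ∫ _, (1 : ℝ) ∂μ :=
          integral_mono_ae hz (integrable_const _) (hz'.mono fun p hp => hp.2)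
      _ = 1 := by simp
  by_cases hp : R ∈ Set.Ioo (0 : ℝ) 1
  · have hint (t : Finset (Fin m)) (k : Fin m) :
        Integrable (fun p => if k ∈ t then z p else 1 - z p) μ := by
      split_ifs
      · exact hz
      · exact (integrable_const _).sub hz
    have hint' (t : Finset (Fin m)) : Integrable (fun S : Fin m → Z =>
        (∏ k, (if k ∈ t then z (S k) else 1 - z (S k))) * Real.exp (m * klBin (t.card / m) R))
        (Measure.pi fun _ => μ) :=
      (Integrable.fintype_prod (hint t)).mul_const _
    calc _ ≤ ∫⁻ S, ENNReal.ofReal (∑ t : Finset (Fin m),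
          (∏ k, (if k ∈ t then z (S k) else 1 - z (S k))) *
            Real.exp (m * klBin (t.card / m) R)) ∂(Measure.pi fun _ : Fin m => μ) := by
          refine lintegral_mono_ae ?_
          filter_upwards [ae_pi_forall μ hz'] with S hS
          exact ENNReal.ofReal_le_ofReal
            ((convexOn_exp_mul_klBin_left hp (Nat.cast_nonneg m)).map_average_le_sum_finset _ hS)
      _ = ENNReal.ofReal (∫ S, ∑ t : Finset (Fin m),
          (∏ k, (if k ∈ t then z (S k) else 1 - z (S k))) *
            Real.exp (m * klBin (t.card / m) R) ∂(Measure.pi fun _ : Fin m => μ)) := by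
          rw [ofReal_integral_eq_lintegral_ofReal (integrable_finsetSum _ fun t _ => hint' t)]
          filter_upwards [ae_pi_forall μ hz'] with S hS
          refine Finset.sum_nonneg fun t _ =>
            mul_nonneg (Finset.prod_nonneg fun k _ => ?_) (Real.exp_nonneg _)
          split_ifs
          · exact (hS k).1
          · exact sub_nonneg.2 (hS k).2
      _ = ENNReal.ofReal (xi m) := by
          congr 1
          rw [integral_finsetSum _ fun t _ => hint' t, ← sum_finset_pow_mul_exp_klBin hm hp]
          refine Finset.sum_congr rfl fun t _ => ?_
          rw [integral_mul_const,
            integral_fintype_prod_eq_prod (fun k p => if k ∈ t then z p else 1 - z p)]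
          congr 1
          refine Finset.prod_congr rfl fun k _ => ?_
          split_ifs
          · rfl
          · rw [integral_sub (integrable_const _) hz]; simp [hR]
  · have hR' : R = 0 ∨ R = 1 := by
      by_contra! h
      exact hp ⟨lt_of_le_of_ne hR0 h.1.symm, lt_of_le_of_ne hR1 h.2⟩
    calc _ ≤ ∫⁻ _, 1 ∂(Measure.pi fun _ : Fin m => μ) := by
          refine lintegral_mono_ae ?_
          filter_upwards [ae_pi_average_eq_of_integral_eq μ hm hz hz'] with S hS
          rcases hR' with h | h
          · rw [hS.1 h, h]; simp [klBin]
          · rw [hS.2 h, h]; simp [klBin]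
      _ ≤ ENNReal.ofReal (xi m) := by simpa using one_le_xi hm

theorem exists_affine_le_mul_log_div {ι : Type*} [MeasurableSpace ι] (Q : Measure ι)
    {x y : ι → ℝ} (hx : Integrable x Q) (hy : Integrable y Q)
    (hx0 : ∀ᵐ i ∂Q, 0 ≤ x i) (hy0 : ∀ᵐ i ∂Q, 0 ≤ y i)
    (hyx : ∀ᵐ i ∂Q, y i = 0 → x i = 0) :
    ∃ a b : ℝ, (∀ᵐ i ∂Q, a * x i + b * y i ≤ x i * Real.log (x i / y i)) ∧
      a * ∫ i, x i ∂Q + b * ∫ i, y i ∂Q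
        = (∫ i, x i ∂Q) * Real.log ((∫ i, x i ∂Q) / ∫ i, y i ∂Q) := by
  by_cases hX : ∫ i, x i ∂Q = 0
  · refine ⟨0, 0, ?_, by simp [hX]⟩
    filter_upwards [(integral_eq_zero_iff_of_nonneg_ae hx0 hx).1 hX] with i hi
    have : x i = 0 := hi
    simp [this]
  have hY : ∫ i, y i ∂Q ≠ 0 := by
    intro hY
    apply hX
    have : x =ᵐ[Q] 0 := by
      filter_upwards [(integral_eq_zero_iff_of_nonneg_ae hy0 hy).1 hY, hyx] with i hi h
      exact h hi
    rw [integral_congr_ae this]; simp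
  set X := ∫ i, x i ∂Q
  set Y := ∫ i, y i ∂Q
  have hX' : 0 < X := lt_of_le_of_ne (integral_nonneg_of_ae hx0) (Ne.symm hX)
  have hY' : 0 < Y := lt_of_le_of_ne (integral_nonneg_of_ae hy0) (Ne.symm hY)
  refine ⟨Real.log (X / Y) + 1, -(X / Y), ?_, by field_simp; ring⟩
  filter_upwards [hx0, hy0, hyx] with i hxi hyi h
  rcases hxi.eq_or_lt with hxi | hxi
  · rw [← hxi]
    have := mul_nonneg (div_pos hX' hY').le hyi
    simp only [mul_zero, zero_add, zero_mul]
    linarith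
  have hyi : 0 < y i := lt_of_le_of_ne hyi fun h' => hxi.ne' (h h'.symm)
  have ht := Real.log_le_sub_one_of_pos (x := (X / Y) / (x i / y i)) (by positivity)
  rw [Real.log_div (by positivity) (by positivity)] at ht
  have := mul_le_mul_of_nonneg_left ht hxi.le
  have e : x i * ((X / Y) / (x i / y i) - 1) = X / Y * y i - x i := by field_simp
  rw [e] at this
  linarith

/-- A form of the Donsker–Varadhan change of measure inequality. -/
theorem integral_le_integral_log_rnDeriv_add_log {ι : Type*} [MeasurableSpace ι]
    {P Q : Measure ι} [IsProbabilityMeasure P] [IsProbabilityMeasure Q] (hQP : Q ≪ P)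
    (hlog : Integrable (fun i => Real.log ((Q.rnDeriv P) i).toReal) Q)
    {h g : ι → ℝ} (hh : Integrable h Q) (hg : Measurable g) (hhg : h ≤ᵐ[Q] g)
    {C : ℝ} (hC : 0 < C)
    (hgC : ∫⁻ i, ENNReal.ofReal (Real.exp (g i)) ∂P ≤ ENNReal.ofReal C) :
    ∫ i, h i ∂Q ≤ ∫ i, Real.log ((Q.rnDeriv P) i).toReal ∂Q + Real.log C := by
  set ρ := Q.rnDeriv P with hρ
  set w : ι → ℝ := fun i => Real.exp (g i) / (ρ i).toReal with hw
  have hρpos : ∀ᵐ i ∂Q, 0 < (ρ i).toReal := by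
    filter_upwards [Measure.rnDeriv_pos hQP, hQP.ae_le (Measure.rnDeriv_ne_top Q P)] with i h1 h2
    exact ENNReal.toReal_pos h1.ne' h2
  have hwm : Measurable w := hg.exp.div (Measure.measurable_rnDeriv Q P).ennreal_toReal
  have hw0 : ∀ i, 0 ≤ w i := fun i => div_nonneg (Real.exp_nonneg _) ENNReal.toReal_nonneg
  have hwl : ∫⁻ i, ENNReal.ofReal (w i) ∂Q ≤ ENNReal.ofReal C := by
    rw [← lintegral_rnDeriv_mul hQP hwm.ennreal_ofReal.aemeasurable]
    refine (lintegral_mono_ae ?_).trans hgC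
    filter_upwards [Measure.rnDeriv_ne_top Q P] with i hi
    replace hi : ρ i ≠ ⊤ := hi
    change ρ i * _ ≤ _
    rw [← ENNReal.ofReal_toReal hi, ← ENNReal.ofReal_mul ENNReal.toReal_nonneg]
    refine ENNReal.ofReal_le_ofReal ?_
    change (ρ i).toReal * (Real.exp (g i) / (ρ i).toReal) ≤ _
    by_cases h0 : (ρ i).toReal = 0
    · rw [h0]; simp [Real.exp_nonneg]
    · rw [mul_div_cancel₀ _ h0]
  have hwi : Integrable w Q :=
    ⟨hwm.aestronglyMeasurable, by
      rw [hasFiniteIntegral_iff_ofReal (Filter.Eventually.of_forall hw0)]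
      exact hwl.trans_lt ENNReal.ofReal_lt_top⟩
  have hwC : ∫ i, w i ∂Q ≤ C := by
    rw [← ofReal_integral_eq_lintegral_ofReal hwi (Filter.Eventually.of_forall hw0)] at hwl
    exact (ENNReal.ofReal_le_ofReal_iff hC.le).1 hwl
  have hle : ∀ᵐ i ∂Q, h i - Real.log (ρ i).toReal ≤ w i / C + (Real.log C - 1) := by
    filter_upwards [hρpos, hhg] with i hi hhi
    have hwp : 0 < w i := div_pos (Real.exp_pos _) hi
    have := Real.log_le_sub_one_of_pos (div_pos hwp hC)
    rw [Real.log_div hwp.ne' hC.ne', hw, Real.log_div (Real.exp_pos _).ne' hi.ne',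
      Real.log_exp] at this
    linarith
  have hint := integral_mono_ae (hh.sub hlog) ((hwi.div_const C).add (integrable_const _)) hle
  have e1 : ∫ i, (h - fun i => Real.log (ρ i).toReal) i ∂Q
      = ∫ i, h i ∂Q - ∫ i, Real.log (ρ i).toReal ∂Q := integral_sub hh hlog
  have e2 : ∫ i, (w i / C + (Real.log C - 1)) ∂Q
      = (∫ i, w i ∂Q) / C + (Real.log C - 1) := by
    rw [integral_add (hwi.div_const C) (integrable_const _), integral_div]; simp
  have hint' : ∫ i, h i ∂Q - ∫ i, Real.log (ρ i).toReal ∂Q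
      ≤ (∫ i, w i ∂Q) / C + (Real.log C - 1) := by
    rw [← e1, ← e2]; exact hint
  have := (div_le_one hC).2 hwC
  linarith

theorem klBin_integral_le_of_lintegral_exp_le {ι : Type*} [MeasurableSpace ι]
    {P Q : Measure ι} [IsProbabilityMeasure P] [IsProbabilityMeasure Q] (hQP : Q ≪ P)
    (hlog : Integrable (fun i => Real.log ((Q.rnDeriv P) i).toReal) Q)
    {q p : ι → ℝ} (hq : Measurable q) (hp : Measurable p)
    (hq01 : ∀ i, q i ∈ Set.Icc (0 : ℝ) 1) (hp01 : ∀ i, p i ∈ Set.Icc (0 : ℝ) 1)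
    (hqp : ∀ᵐ i ∂P, (p i = 0 → q i = 0) ∧ (p i = 1 → q i = 1))
    {c C : ℝ} (hc : 0 < c) (hC : 0 < C)
    (hle : ∫⁻ i, ENNReal.ofReal (Real.exp (c * klBin (q i) (p i))) ∂P ≤ ENNReal.ofReal C) :
    klBin (∫ i, q i ∂Q) (∫ i, p i ∂Q) ≤
      c⁻¹ * (∫ i, Real.log ((Q.rnDeriv P) i).toReal ∂Q + Real.log C) := by
  have hqi : Integrable q Q :=
    Integrable.of_mem_Icc 0 1 hq.aemeasurable (Filter.Eventually.of_forall hq01)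
  have hpi : Integrable p Q :=
    Integrable.of_mem_Icc 0 1 hp.aemeasurable (Filter.Eventually.of_forall hp01)
  have hqi' : Integrable (fun i => 1 - q i) Q := (integrable_const _).sub hqi
  have hpi' : Integrable (fun i => 1 - p i) Q := (integrable_const _).sub hpi
  have hqp' : ∀ᵐ i ∂Q, (p i = 0 → q i = 0) ∧ (p i = 1 → q i = 1) := hQP.ae_le hqp
  obtain ⟨a, b, hab, hab'⟩ := exists_affine_le_mul_log_div Q hqi hpi
    (Filter.Eventually.of_forall fun i => (hq01 i).1)
    (Filter.Eventually.of_forall fun i => (hp01 i).1) (hqp'.mono fun i hi => hi.1)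
  obtain ⟨a', b', hb, hb'⟩ := exists_affine_le_mul_log_div Q hqi' hpi'
    (Filter.Eventually.of_forall fun i => sub_nonneg.2 (hq01 i).2)
    (Filter.Eventually.of_forall fun i => sub_nonneg.2 (hp01 i).2)
    (hqp'.mono fun i hi h => by rw [hi.2 (by linarith), sub_self])
  have hone {f : ι → ℝ} (hf : Integrable f Q) : ∫ i, (1 - f i) ∂Q = 1 - ∫ i, f i ∂Q := by
    rw [integral_sub (integrable_const _) hf]; simp
  have hint1 : Integrable (fun i => a * q i + b * p i) Q :=
    (hqi.const_mul a).add (hpi.const_mul b)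
  have hint2 : Integrable (fun i => a' * (1 - q i) + b' * (1 - p i)) Q :=
    (hqi'.const_mul a').add (hpi'.const_mul b')
  have hval : ∫ i, c * ((a * q i + b * p i) + (a' * (1 - q i) + b' * (1 - p i))) ∂Q
      = c * klBin (∫ i, q i ∂Q) (∫ i, p i ∂Q) := by
    rw [integral_const_mul, integral_add hint1 hint2,
      integral_add (hqi.const_mul a) (hpi.const_mul b),
      integral_add (hqi'.const_mul a') (hpi'.const_mul b'), integral_const_mul,
      integral_const_mul, integral_const_mul, integral_const_mul, hab', hb', hone hqi,
      hone hpi, klBin]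
  have hkl : Measurable fun i => c * klBin (q i) (p i) := by
    unfold klBin; fun_prop
  have := integral_le_integral_log_rnDeriv_add_log hQP hlog
    ((hint1.add hint2).const_mul c) hkl
    (by
      filter_upwards [hab, hb] with i h1 h2
      exact mul_le_mul_of_nonneg_left (add_le_add h1 h2) hc.le) hC hle
  rw [inv_mul_eq_div, le_div_iff₀ hc, mul_comm, ← hval]
  exact this

theorem ofReal_one_sub_le_measure_lintegral_le {α : Type*} [MeasurableSpace α] (μ : Measure α)
    [IsProbabilityMeasure μ] {G : α → ENNReal} (hG : Measurable G) {B δ : ℝ} (hB : 0 < B)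
    (hδ : 0 < δ) (hGB : ∫⁻ a, G a ∂μ ≤ ENNReal.ofReal B) :
    ENNReal.ofReal (1 - δ) ≤ μ {a | G a < ENNReal.ofReal (B / δ)} := by
  have hpos : 0 < B / δ := div_pos hB hδ
  have hmarkov : μ {a | ENNReal.ofReal (B / δ) ≤ G a} ≤ ENNReal.ofReal δ := by
    refine (meas_ge_le_lintegral_div hG.aemeasurable (by simpa using hpos)
      ENNReal.ofReal_ne_top).trans ?_
    refine (ENNReal.div_le_div_right hGB _).trans_eq ?_
    rw [← ENNReal.ofReal_div_of_pos hpos]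
    congr 1
    field_simp
  have hcompl : {a | G a < ENNReal.ofReal (B / δ)} = {a | ENNReal.ofReal (B / δ) ≤ G a}ᶜ := by
    ext; simp
  rw [hcompl, prob_compl_eq_one_sub (measurableSet_le measurable_const hG),
    ENNReal.ofReal_sub _ hδ.le, ENNReal.ofReal_one]
  exact tsub_le_tsub_left hmarkov 1

/-- PAC-Bayesian theorem for the Gibbs risk: with probability at least `1 - δ` over
`S ∼ D^m`, simultaneously for all posteriors `Q`,
`kl(R_S(G_Q) ‖ R_D(G_Q)) ≤ (1/m)·[KL(Q‖P) + ln(ξ(m)/δ)]`. -/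
theorem statement11 {X ι : Type*} [MeasurableSpace X] [MeasurableSpace ι]
    (D : Measure (X × ℝ)) [IsProbabilityMeasure D]
    (hY : ∀ᵐ p ∂D, p.2 = 1 ∨ p.2 = -1)
    (F : ι → X → ℝ) (hF : ∀ i x, F i x ∈ Set.Icc (-1 : ℝ) 1)
    (hFmeas : Measurable fun q : ι × X => F q.1 q.2)
    (P : Measure ι) [IsProbabilityMeasure P]
    (δ : ℝ) (hδ : δ ∈ Set.Ioc (0 : ℝ) 1)
    (m : ℕ) (hm : 0 < m) :
    ENNReal.ofReal (1 - δ) ≤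
      (Measure.pi fun _ : Fin m => D)
        {S | ∀ Q : Measure ι, IsProbabilityMeasure Q →
          ((klBin (empGibbs F S Q) (trueGibbs F D Q) : ℝ) : EReal) ≤
            (((m : ℝ)⁻¹ : ℝ) : EReal) *
              (klDivE Q P + ((Real.log (xi m / δ) : ℝ) : EReal))} := by
  set μ := Measure.pi fun _ : Fin m => D
  have hm' : (0 : ℝ) < m := by exact_mod_cast hm
  set z : ι → X × ℝ → ℝ := fun i p => (1 - p.2 * F i p.1) / 2 with hz
  set r : (Fin m → X × ℝ) → ι → ℝ := fun S i => (m : ℝ)⁻¹ * ∑ k, z i (S k) with hr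
  set R : ι → ℝ := fun i => ∫ p, z i p ∂D with hR
  have hzmeas : Measurable (Function.uncurry z) := by
    have : Measurable fun q : ι × X × ℝ => F q.1 q.2.1 :=
      hFmeas.comp (measurable_fst.prodMk (measurable_fst.comp measurable_snd))
    unfold Function.uncurry
    fun_prop
  have hzi (i : ι) : Measurable (z i) := hzmeas.comp measurable_prodMk_left
  have hrmeas : Measurable fun q : (Fin m → X × ℝ) × ι => r q.1 q.2 := by
    refine (Finset.measurable_fun_sum _ fun k _ => ?_).const_mul _
    exact hzmeas.comp (measurable_snd.prodMk ((measurable_pi_apply k).comp measurable_fst))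
  have hRmeas : Measurable R := hzmeas.stronglyMeasurable.integral_prod_right.measurable
  have hz_mem (i : ι) (p : X × ℝ) (hp : p.2 = 1 ∨ p.2 = -1) : z i p ∈ Set.Icc (0 : ℝ) 1 := by
    obtain ⟨h1, h2⟩ := hF i p.1
    rcases hp with hp | hp <;> simp only [hz, hp, Set.mem_Icc] <;> constructor <;> linarith
  have hz_ae (i : ι) : ∀ᵐ p ∂D, z i p ∈ Set.Icc (0 : ℝ) 1 := hY.mono (hz_mem i)
  have hzint (i : ι) : Integrable (z i) D :=
    Integrable.of_mem_Icc 0 1 (hzi i).aemeasurable (hz_ae i)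
  have hR01 (i : ι) : R i ∈ Set.Icc (0 : ℝ) 1 := by
    refine ⟨integral_nonneg_of_ae ((hz_ae i).mono fun p hp => hp.1), ?_⟩
    calc R i ≤ ∫ _, (1 : ℝ) ∂D := integral_mono_ae (hzint i) (integrable_const _)
          ((hz_ae i).mono fun p hp => hp.2)
      _ = 1 := by simp
  have hPhi : Measurable fun q : (Fin m → X × ℝ) × ι =>
      ENNReal.ofReal (Real.exp (m * klBin (r q.1 q.2) (R q.2))) := by
    have : Measurable fun q : (Fin m → X × ℝ) × ι => R q.2 := hRmeas.comp measurable_snd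
    unfold klBin
    fun_prop
  have hexp : ∫⁻ S, ∫⁻ i, ENNReal.ofReal (Real.exp (m * klBin (r S i) (R i))) ∂P ∂μ
      ≤ ENNReal.ofReal (xi m) := by
    rw [lintegral_lintegral_swap hPhi.aemeasurable]
    calc _ ≤ ∫⁻ _, ENNReal.ofReal (xi m) ∂P :=
          lintegral_mono fun i => lintegral_exp_klBin_le_xi D hm (hzint i) (hz_ae i)
      _ = _ := by simp
  have hxi : 0 < xi m := zero_lt_one.trans_le (one_le_xi hm)
  have hdeg : ∀ᵐ S ∂μ, ∀ᵐ i ∂P, (R i = 0 → r S i = 0) ∧ (R i = 1 → r S i = 1) := by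
    rw [Measure.ae_ae_comm]
    · exact Filter.Eventually.of_forall fun i =>
        ae_pi_average_eq_of_integral_eq D hm (hzint i) (hz_ae i)
    · have h0 (c : ℝ) : MeasurableSet {q : (Fin m → X × ℝ) × ι | R q.2 = c → r q.1 q.2 = c} :=
        (measurableSet_eq_fun (hRmeas.comp measurable_snd) measurable_const).imp
          (measurableSet_eq_fun hrmeas measurable_const)
      exact (h0 0).inter (h0 1)
  refine (ofReal_one_sub_le_measure_lintegral_le μ hPhi.lintegral_prod_right' hxi hδ.1
    hexp).trans (measure_mono_ae ?_)
  filter_upwards [hdeg, ae_pi_forall D hY] with S hS hSY hG Q hQ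
  by_cases hcond : Q ≪ P ∧ Integrable (fun i => Real.log ((Q.rnDeriv P) i).toReal) Q
  · rw [klDivE, if_pos hcond, ← EReal.coe_add, ← EReal.coe_mul, EReal.coe_le_coe_iff]
    refine klBin_integral_le_of_lintegral_exp_le hcond.1 hcond.2
      (hrmeas.comp measurable_prodMk_left) hRmeas (fun i => ⟨?_, ?_⟩) hR01 hS hm'
      (div_pos hxi hδ.1) (le_of_lt hG)
    · exact mul_nonneg (inv_nonneg.2 hm'.le)
        (Finset.sum_nonneg fun k _ => (hz_mem i (S k) (hSY k)).1)
    · change (m : ℝ)⁻¹ * ∑ k, z i (S k) ≤ 1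
      rw [inv_mul_le_iff₀ hm', mul_one]
      refine (Finset.sum_le_sum fun k _ => (hz_mem i (S k) (hSY k)).2).trans ?_
      simp
  · rw [klDivE, if_neg hcond, EReal.top_add_coe, EReal.coe_mul_top_of_pos (inv_pos.2 hm')]
    exact le_top
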